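/- The reduction relation →βΣ, the union of β-reduction with the rewrite rule [α:type, β:type] term(arrow α β) ⇝ term α → term β of the HOL signature Σ in the λΠ-calculus modulo rewriting, is strongly normalizing on well-typed terms. -/

import Mathlib

set_option autoImplicit false

namespace HolDk

/-! ### Dedukti: the λΠ-calculus modulo rewriting, with de Bruijn indices.

Terms `M, N, A, B ::= x | c | Type | Kind | Πx:A.B | λx:A.M | M N`. -/

inductive DTm : Type
  | var   : ℕ → DTm
  | const : ℕ → DTm
  | type  : DTm
  | kind  : DTm
  | pi    : DTm → DTm → DTm
  | lam   : DTm → DTm → DTm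
  | app   : DTm → DTm → DTm
  deriving DecidableEq

namespace DTm

/-- Shift the free de Bruijn indices `≥ c` up by `d`. -/
def shift (d : ℕ) : ℕ → DTm → DTm
  | c, var n => if n < c then var n else var (n + d)
  | _, const k => const k
  | _, type => type
  | _, kind => kind
  | c, pi A B => pi (shift d c A) (shift d (c+1) B)
  | c, lam A M => lam (shift d c A) (shift d (c+1) M)
  | c, app M N => app (shift d c M) (shift d c N)

/-- Lift a simultaneous substitution under one binder. -/
def liftSub (σ : ℕ → DTm) : ℕ → DTm
  | 0 => var 0
  | n+1 => shift 1 0 (σ n)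

/-- Simultaneous substitution. -/
def subst (σ : ℕ → DTm) : DTm → DTm
  | var n => σ n
  | const k => const k
  | type => type
  | kind => kind
  | pi A B => pi (subst σ A) (subst (liftSub σ) B)
  | lam A M => lam (subst σ A) (subst (liftSub σ) M)
  | app M N => app (subst σ M) (subst σ N)

/-- Substitution `[N/x]M` of `N` for the de Bruijn index `0` in `M`. -/
def subst0 (M N : DTm) : DTm :=
  subst (fun n => match n with | 0 => N | n+1 => var n) M

/-- Non-dependent product `A → B`. -/
def arr (A B : DTm) : DTm := pi A (shift 1 0 B)

end DTm

/-- Signatures `Σ ::= · | Σ, c : A | Σ, [Γ] M ⇝ N`. -/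
inductive Sig : Type
  | empty : Sig
  | pushConst : Sig → ℕ → DTm → Sig
  | pushRule : Sig → List DTm → DTm → DTm → Sig

/-- Lookup of the type of a constant in a signature. -/
def Sig.constType : Sig → ℕ → Option DTm
  | .empty, _ => none
  | .pushConst S c A, d => if d = c then some A else S.constType d
  | .pushRule S _ _ _, d => S.constType d

/-- Membership of a rewrite rule `[Γ] M ⇝ N` in a signature. -/
def Sig.hasRule : Sig → List DTm → DTm → DTm → Prop
  | .empty, _, _, _ => False
  | .pushConst S _ _, G, M, N => S.hasRule G M N
  | .pushRule S G' M' N', G, M, N => (G = G' ∧ M = M' ∧ N = N') ∨ S.hasRule G M N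

/-- Pure β-reduction (one step, contextual closure). -/
inductive RedBeta : DTm → DTm → Prop
  | beta (A M N) : RedBeta (.app (.lam A M) N) (M.subst0 N)
  | appL {M M'} (N) : RedBeta M M' → RedBeta (.app M N) (.app M' N)
  | appR (M) {N N'} : RedBeta N N' → RedBeta (.app M N) (.app M N')
  | lamTy {A A'} (M) : RedBeta A A' → RedBeta (.lam A M) (.lam A' M)
  | lamBody (A) {M M'} : RedBeta M M' → RedBeta (.lam A M) (.lam A M')
  | piL {A A'} (B) : RedBeta A A' → RedBeta (.pi A B) (.pi A' B)
  | piR (A) {B B'} : RedBeta B B' → RedBeta (.pi A B) (.pi A B')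

/-- The reduction relation `→βΣ`: β-reduction together with the rewrite rules of
the signature (one step, contextual closure). -/
inductive Red (S : Sig) : DTm → DTm → Prop
  | beta (A M N) : Red S (.app (.lam A M) N) (M.subst0 N)
  | rew {G L R} (σ : ℕ → DTm) : S.hasRule G L R → Red S (L.subst σ) (R.subst σ)
  | appL {M M'} (N) : Red S M M' → Red S (.app M N) (.app M' N)
  | appR (M) {N N'} : Red S N N' → Red S (.app M N) (.app M N')
  | lamTy {A A'} (M) : Red S A A' → Red S (.lam A M) (.lam A' M)
  | lamBody (A) {M M'} : Red S M M' → Red S (.lam A M) (.lam A M')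
  | piL {A A'} (B) : Red S A A' → Red S (.pi A B) (.pi A' B)
  | piR (A) {B B'} : Red S B B' → Red S (.pi A B) (.pi A B')

/-- The conversion `≡βΣ`: reflexive symmetric transitive closure of `→βΣ`. -/
def Conv (S : Sig) : DTm → DTm → Prop := Relation.EqvGen (Red S)

mutual
/-- Signature formation `Σ signature`. -/
inductive SigWf : Sig → Prop
  | empty : SigWf .empty
  | pushConst {S : Sig} {c : ℕ} {A s : DTm} : SigWf S → Typed S [] A s →
      (s = DTm.type ∨ s = DTm.kind) → S.constType c = none →
      SigWf (S.pushConst c A)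
  | pushRule {S : Sig} {G : List DTm} {M N A : DTm} : SigWf S →
      Typed S G M A → Typed S G N A → SigWf (S.pushRule G M N)

/-- Context formation `Σ | Γ context` (contexts are lists, head = most recent binding). -/
inductive CtxWf : Sig → List DTm → Prop
  | nil {S : Sig} : SigWf S → CtxWf S []
  | cons {S : Sig} {G : List DTm} {A : DTm} : CtxWf S G → Typed S G A DTm.type →
      CtxWf S (A :: G)

/-- The typing judgment `Σ | Γ ⊢ M : A` of the λΠ-calculus modulo rewriting. -/
inductive Typed : Sig → List DTm → DTm → DTm → Prop
  | var {S : Sig} {G : List DTm} {n : ℕ} {A : DTm} : CtxWf S G → G[n]? = some A →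
      Typed S G (.var n) (A.shift (n+1) 0)
  | const {S : Sig} {G : List DTm} {c : ℕ} {A : DTm} : CtxWf S G →
      S.constType c = some A → Typed S G (.const c) A
  | type {S : Sig} {G : List DTm} : CtxWf S G → Typed S G .type .kind
  | prod {S : Sig} {G : List DTm} {A B s : DTm} : Typed S G A .type →
      Typed S (A :: G) B s → (s = DTm.type ∨ s = DTm.kind) → Typed S G (.pi A B) s
  | abs {S : Sig} {G : List DTm} {A M B : DTm} : Typed S G A .type →
      Typed S (A :: G) M B → Typed S G (.lam A M) (.pi A B)
  | app {S : Sig} {G : List DTm} {M N A B : DTm} : Typed S G M (.pi A B) →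
      Typed S G N A → Typed S G (.app M N) (B.subst0 N)
  | conv {S : Sig} {G : List DTm} {M A B : DTm} : Typed S G M A →
      Typed S G B DTm.type → Conv S A B → Typed S G M B
end

/-! ### HOL -/

/-- HOL types: type variables, `bool`, `ind`, and arrow types. -/
inductive HTy : Type
  | tvar : ℕ → HTy
  | bool : HTy
  | ind  : HTy
  | arr  : HTy → HTy → HTy
  deriving DecidableEq

/-- HOL terms (simply typed λ-terms, de Bruijn indices for term variables),
with the polymorphic constants `(=_A)` and `select_A`. -/
inductive HTm : Type
  | var    : ℕ → HTm
  | lam    : HTy → HTm → HTm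
  | app    : HTm → HTm → HTm
  | eq     : HTy → HTm
  | select : HTy → HTm
  deriving DecidableEq

/-- The HOL proposition `M = N` (at type `A`), i.e. `(=_A) M N`. -/
def HTm.heq (A : HTy) (M N : HTm) : HTm := .app (.app (.eq A) M) N

/-- HOL typing: `Δ ⊢ M : A` where `Δ` types the term variables. -/
inductive HTyped : List HTy → HTm → HTy → Prop
  | var {D : List HTy} {n : ℕ} {A : HTy} : D[n]? = some A → HTyped D (.var n) A
  | lam {D : List HTy} {A B : HTy} {M : HTm} : HTyped (A :: D) M B →
      HTyped D (.lam A M) (A.arr B)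
  | app {D : List HTy} {A B : HTy} {M N : HTm} : HTyped D M (A.arr B) →
      HTyped D N A → HTyped D (.app M N) B
  | eq {D : List HTy} {A : HTy} : HTyped D (.eq A) (A.arr (A.arr .bool))
  | select {D : List HTy} {A : HTy} : HTyped D (.select A) ((A.arr .bool).arr A)

namespace HTm

/-- Shift the free term-variable indices `≥ c` up by `d`. -/
def shift (d : ℕ) : ℕ → HTm → HTm
  | c, var n => if n < c then var n else var (n + d)
  | c, lam A M => lam A (shift d (c+1) M)
  | c, app M N => app (shift d c M) (shift d c N)
  | _, eq A => eq A
  | _, select A => select A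

def liftSub (σ : ℕ → HTm) : ℕ → HTm
  | 0 => var 0
  | n+1 => shift 1 0 (σ n)

/-- Simultaneous capture-avoiding substitution of term variables. -/
def substF (σ : ℕ → HTm) : HTm → HTm
  | var n => σ n
  | lam A M => lam A (substF (liftSub σ) M)
  | app M N => app (substF σ M) (substF σ N)
  | eq A => eq A
  | select A => select A

/-- Substitution `[N/x]M` for the de Bruijn index `0`. -/
def subst0 (M N : HTm) : HTm :=
  substF (fun n => match n with | 0 => N | n+1 => var n) M

/-- Simultaneous (parallel) substitution `M[M₁/x₁, …, Mₙ/xₙ]` given by a list. -/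
def substL (σ : List HTm) (M : HTm) : HTm :=
  substF (fun n => (σ[n]?).getD (var n)) M

end HTm

/-- Type substitution `A[A₁/α₁, …, Aₘ/αₘ]` on HOL types. -/
def HTy.tsub (θ : List HTy) : HTy → HTy
  | .tvar n => (θ[n]?).getD (.tvar n)
  | .bool => .bool
  | .ind => .ind
  | .arr A B => .arr (A.tsub θ) (B.tsub θ)

/-- Type substitution on HOL terms. -/
def HTm.tsub (θ : List HTy) : HTm → HTm
  | .var n => .var n
  | .lam A M => .lam (A.tsub θ) (M.tsub θ)
  | .app M N => .app (M.tsub θ) (N.tsub θ)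
  | .eq A => .eq (A.tsub θ)
  | .select A => .select (A.tsub θ)

/-- All free type variables of a HOL type are `< n`. -/
def HTy.tvLt (n : ℕ) : HTy → Prop
  | .tvar j => j < n
  | .bool => True
  | .ind => True
  | .arr A B => A.tvLt n ∧ B.tvLt n

/-- All free type variables of a HOL term are `< n`. -/
def HTm.tvLt (n : ℕ) : HTm → Prop
  | .var _ => True
  | .lam A M => A.tvLt n ∧ M.tvLt n
  | .app M N => M.tvLt n ∧ N.tvLt n
  | .eq A => A.tvLt n
  | .select A => A.tvLt n

/-- One-step β-reduction of HOL terms (contextual closure). -/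
inductive HBeta : HTm → HTm → Prop
  | beta (A : HTy) (M N : HTm) : HBeta (.app (.lam A M) N) (M.subst0 N)
  | appL {M M'} (N) : HBeta M M' → HBeta (.app M N) (.app M' N)
  | appR (M) {N N'} : HBeta N N' → HBeta (.app M N) (.app M N')
  | lamBody (A) {M M'} : HBeta M M' → HBeta (.lam A M) (.lam A M')

/-- HOL derivations `Γ ⊢ φ` (Fig. 2), in an ambient term-variable context `Δ`,
with hypotheses `Γ` a finite set of propositions.  The `Subst` rule is split
into a type-substitution rule and a term-substitution rule. -/
inductive HDeriv : List HTy → Finset HTm → HTm → Type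
  | refl {D : List HTy} (A : HTy) (M : HTm) :
      HTyped D M A → HDeriv D ∅ (HTm.heq A M M)
  | absThm {D : List HTy} {G : Finset HTm} (A B : HTy) (M N : HTm) :
      HDeriv (A :: D) (G.image (HTm.shift 1 0)) (HTm.heq B M N) →
      HDeriv D G (HTm.heq (A.arr B) (.lam A M) (.lam A N))
  | appThm {D : List HTy} {G G' : Finset HTm} (A B : HTy) (F Gt M N : HTm) :
      HDeriv D G (HTm.heq (A.arr B) F Gt) → HDeriv D G' (HTm.heq A M N) →
      HDeriv D (G ∪ G') (HTm.heq B (F.app M) (Gt.app N))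
  | beta {D : List HTy} (A B : HTy) (M : HTm) :
      HTyped (A :: D) M B →
      HDeriv (A :: D) ∅ (HTm.heq B (.app (.lam A (M.shift 1 1)) (.var 0)) M)
  | assume {D : List HTy} (φ : HTm) : HTyped D φ .bool → HDeriv D {φ} φ
  | eqMp {D : List HTy} {G G' : Finset HTm} (φ ψ : HTm) :
      HDeriv D G (HTm.heq .bool φ ψ) → HDeriv D G' φ →
      HDeriv D (G ∪ G') ψ
  | deductAntiSym {D : List HTy} {G G' : Finset HTm} (φ ψ : HTm) :
      HDeriv D G φ → HDeriv D G' ψ →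
      HDeriv D (G.erase ψ ∪ G'.erase φ) (HTm.heq .bool φ ψ)
  | typeSubst {D : List HTy} {G : Finset HTm} {φ : HTm} (θ : List HTy) :
      HDeriv D G φ →
      HDeriv (D.map (HTy.tsub θ)) (G.image (HTm.tsub θ)) (φ.tsub θ)
  | termSubst {D : List HTy} {G : Finset HTm} {φ : HTm} {D' : List HTy} (σ : List HTm) :
      σ.length = D.length →
      (∀ (i : ℕ) (A : HTy), D[i]? = some A → ∃ t, σ[i]? = some t ∧ HTyped D' t A) →
      HDeriv D G φ →
      HDeriv D' (G.image (HTm.substL σ)) (HTm.substL σ φ)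

/-! ### The Dedukti signature Σ for HOL -/

def cTy : DTm := .const 0
def dBool : DTm := .const 1
def dInd : DTm := .const 2
def tArr (a b : DTm) : DTm := .app (.app (.const 3) a) b
def tTerm (a : DTm) : DTm := .app (.const 4) a
def tEq (a x y : DTm) : DTm := .app (.app (.app (.const 5) a) x) y
def tProof (p : DTm) : DTm := .app (.const 7) p
def dRefl : DTm := .const 8
def dFunExt : DTm := .const 9
def dAppThm : DTm := .const 10
def dPropExt : DTm := .const 11
def dEqMp : DTm := .const 12
def dImp : DTm := .const 13
def dForall : DTm := .const 14

def tyArrow : DTm := DTm.arr cTy (DTm.arr cTy cTy)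
def tyTerm : DTm := DTm.arr cTy .type
def tyEq : DTm := .pi cTy (tTerm (tArr (.var 0) (tArr (.var 0) dBool)))
def tySelect : DTm := .pi cTy (tTerm (tArr (tArr (.var 0) dBool) (.var 0)))
def tyProof : DTm := DTm.arr (tTerm dBool) .type
def tyRefl : DTm :=
  .pi cTy (.pi (tTerm (.var 0)) (tProof (tEq (.var 1) (.var 0) (.var 0))))
def tyFunExt : DTm :=
  .pi cTy (.pi cTy (.pi (tTerm (tArr (.var 1) (.var 0))) (.pi (tTerm (tArr (.var 2) (.var 1)))
    (DTm.arr
      (.pi (tTerm (.var 3))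
        (tProof (tEq (.var 3) (.app (.var 2) (.var 0)) (.app (.var 1) (.var 0)))))
      (tProof (tEq (tArr (.var 3) (.var 2)) (.var 1) (.var 0)))))))
def tyAppThm : DTm :=
  .pi cTy (.pi cTy (.pi (tTerm (tArr (.var 1) (.var 0))) (.pi (tTerm (tArr (.var 2) (.var 1)))
    (.pi (tTerm (.var 3)) (.pi (tTerm (.var 4))
      (DTm.arr (tProof (tEq (tArr (.var 5) (.var 4)) (.var 3) (.var 2)))
        (DTm.arr (tProof (tEq (.var 5) (.var 1) (.var 0)))
          (tProof (tEq (.var 4) (.app (.var 3) (.var 1)) (.app (.var 2) (.var 0)))))))))))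
def tyPropExt : DTm :=
  .pi (tTerm dBool) (.pi (tTerm dBool)
    (DTm.arr (DTm.arr (tProof (.var 0)) (tProof (.var 1)))
      (DTm.arr (DTm.arr (tProof (.var 0)) (tProof (.var 1)))
        (tProof (tEq dBool (.var 1) (.var 0))))))
def tyEqMp : DTm :=
  .pi (tTerm dBool) (.pi (tTerm dBool)
    (DTm.arr (tProof (tEq dBool (.var 1) (.var 0)))
      (DTm.arr (tProof (.var 1)) (tProof (.var 0)))))

/-- The rewrite rule `[α : type, β : type] term (arrow α β) ⇝ term α → term β`
(in the context list, the head is the most recent variable `β`). -/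
def arrowRuleCtx : List DTm := [cTy, cTy]
def arrowRuleL : DTm := tTerm (tArr (.var 1) (.var 0))
def arrowRuleR : DTm := DTm.arr (tTerm (.var 1)) (tTerm (.var 0))

def baseSig : Sig :=
  ((((Sig.empty.pushConst 0 .type).pushConst 1 cTy).pushConst 2 cTy).pushConst 3
    tyArrow).pushConst 4 tyTerm

/-- The HOL signature Σ:
`type : Type`, `bool ind : type`, `arrow : type → type → type`, `term : type → Type`,
`eq`, `select`, the rewrite rule `term (arrow α β) ⇝ term α → term β`,
`proof : term bool → Type`, and `Refl`, `FunExt`, `AppThm`, `PropExt`, `EqMp`. -/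
def holSig : Sig :=
  ((((((((baseSig.pushConst 5 tyEq).pushConst 6 tySelect).pushRule arrowRuleCtx
    arrowRuleL arrowRuleR).pushConst 7 tyProof).pushConst 8 tyRefl).pushConst 9
    tyFunExt).pushConst 10 tyAppThm).pushConst 11 tyPropExt).pushConst 12 tyEqMp

/-! ### The translation -/

/-- Translation `|A|` of a HOL type as a Dedukti term; `ρ` gives the Dedukti
de Bruijn index of each HOL type variable. -/
def transTy (ρ : ℕ → ℕ) : HTy → DTm
  | .tvar j => .var (ρ j)
  | .bool => dBool
  | .ind => dInd
  | .arr A B => tArr (transTy ρ A) (transTy ρ B)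

/-- Lift a variable renaming under one binder. -/
def liftVar (ρ : ℕ → ℕ) : ℕ → ℕ
  | 0 => 0
  | n+1 => ρ n + 1

/-- Translation `|M|` of a HOL term as a Dedukti term; `ρT`, `ρt` give the
Dedukti de Bruijn indices of the free HOL type resp. term variables. -/
def transTm (ρT ρt : ℕ → ℕ) : HTm → DTm
  | .var i => .var (ρt i)
  | .lam A M => .lam (tTerm (transTy ρT A)) (transTm (fun j => ρT j + 1) (liftVar ρt) M)
  | .app M N => .app (transTm ρT ρt M) (transTm ρT ρt N)
  | .eq A => .app (.const 5) (transTy ρT A)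
  | .select A => .app (.const 6) (transTy ρT A)

/-- The Dedukti context `x₁ : ‖A₁‖, …, xₖ : ‖Aₖ‖` translating a HOL
term-variable context (to be placed in front of the `n` type variables). -/
def dTermCtx : List HTy → List DTm
  | [] => []
  | A :: D => tTerm (transTy (fun j => D.length + j) A) :: dTermCtx D

/-- The Dedukti context `‖Γ‖ = h₁ : ‖φ₁‖, …` translating HOL hypotheses;
`k` is the number of HOL term variables in scope. -/
def hypCtx (k : ℕ) : List HTm → List DTm
  | [] => []
  | φ :: rest =>
      tProof (transTm (fun j => rest.length + k + j) (fun i => rest.length + i) φ) ::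
        hypCtx k rest

def mkApps (f : DTm) (args : List DTm) : DTm := args.foldl .app f

def mkTyLams : ℕ → DTm → DTm
  | 0, M => M
  | n+1, M => .lam cTy (mkTyLams n M)

/-- `λx₁ : ‖B₁‖. … λxₖ : ‖Bₖ‖. M` (the head of the list is the innermost binder). -/
def bindTerms (ρT : ℕ → ℕ) : List HTy → DTm → DTm
  | [], M => M
  | A :: D, M => bindTerms ρT D (.lam (tTerm (transTy (fun j => ρT j + D.length) A)) M)

/-- Translation `|𝒟|` of a HOL derivation as a Dedukti proof term; `ρT`, `ρt`
give the Dedukti indices of free HOL type/term variables, and `ρh` gives the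
index of the hypothesis variable `h_φ` for each hypothesis `φ`. -/
def transDeriv : {D : List HTy} → {G : Finset HTm} → {φ : HTm} →
    (ρT ρt : ℕ → ℕ) → (ρh : HTm → ℕ) → HDeriv D G φ → DTm
  | _, _, _, ρT, ρt, _, .refl A M _ =>
      .app (.app dRefl (transTy ρT A)) (transTm ρT ρt M)
  | _, _, _, ρT, ρt, ρh, .absThm A B M N d =>
      .app (.app (.app (.app (.app dFunExt (transTy ρT A)) (transTy ρT B))
          (transTm ρT ρt (.lam A M))) (transTm ρT ρt (.lam A N)))
        (.lam (tTerm (transTy ρT A))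
          (transDeriv (fun j => ρT j + 1) (liftVar ρt)
            (fun χ => ρh (HTm.substF (fun i => .var (i - 1)) χ) + 1) d))
  | _, _, _, ρT, ρt, ρh, .appThm A B F Gt M N d1 d2 =>
      mkApps dAppThm [transTy ρT A, transTy ρT B, transTm ρT ρt F, transTm ρT ρt Gt,
        transTm ρT ρt M, transTm ρT ρt N,
        transDeriv ρT ρt ρh d1, transDeriv ρT ρt ρh d2]
  | _, _, _, ρT, ρt, _, .beta _ B M _ =>
      .app (.app dRefl (transTy ρT B)) (transTm ρT ρt M)
  | _, _, _, _, _, ρh, .assume φ _ => .var (ρh φ)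
  | _, _, _, ρT, ρt, ρh, .eqMp φ ψ d1 d2 =>
      mkApps dEqMp [transTm ρT ρt φ, transTm ρT ρt ψ,
        transDeriv ρT ρt ρh d1, transDeriv ρT ρt ρh d2]
  | _, _, _, ρT, ρt, ρh, .deductAntiSym φ ψ d1 d2 =>
      mkApps dPropExt [transTm ρT ρt φ, transTm ρT ρt ψ,
        .lam (tProof (transTm ρT ρt ψ))
          (transDeriv (fun j => ρT j + 1) (fun i => ρt i + 1)
            (fun χ => if χ = ψ then 0 else ρh χ + 1) d1),
        .lam (tProof (transTm ρT ρt φ))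
          (transDeriv (fun j => ρT j + 1) (fun i => ρt i + 1)
            (fun χ => if χ = φ then 0 else ρh χ + 1) d2)]
  | _, _, _, ρT, ρt, ρh, .typeSubst θ d =>
      mkApps
        (mkTyLams θ.length
          (transDeriv (fun j => if j < θ.length then j else ρT j + θ.length)
            (fun i => ρt i + θ.length)
            (fun χ => ρh (HTm.tsub θ χ) + θ.length) d))
        (θ.reverse.map (transTy ρT))
  | _, _, _, ρT, ρt, ρh, @HDeriv.termSubst D₀ _ _ _ σ _ _ d =>
      mkApps
        (bindTerms ρT D₀
          (transDeriv (fun j => ρT j + D₀.length)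
            (fun i => if i < D₀.length then i else ρt (i - D₀.length) + D₀.length)
            (fun χ => ρh (HTm.substL σ χ) + D₀.length) d))
        (σ.reverse.map (transTm ρT ρt))

/-- All free type variables appearing in a HOL derivation are `< n`. -/
def HDeriv.tvLt (n : ℕ) : {D : List HTy} → {G : Finset HTm} → {φ : HTm} →
    HDeriv D G φ → Prop
  | _, _, _, .refl A M _ => A.tvLt n ∧ M.tvLt n
  | _, _, _, .absThm A B M N d =>
      A.tvLt n ∧ B.tvLt n ∧ M.tvLt n ∧ N.tvLt n ∧ HDeriv.tvLt n d
  | _, _, _, .appThm A B F Gt M N d1 d2 =>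
      A.tvLt n ∧ B.tvLt n ∧ F.tvLt n ∧ Gt.tvLt n ∧ M.tvLt n ∧ N.tvLt n ∧
        HDeriv.tvLt n d1 ∧ HDeriv.tvLt n d2
  | _, _, _, .beta A B M _ => A.tvLt n ∧ B.tvLt n ∧ M.tvLt n
  | _, _, _, .assume φ _ => φ.tvLt n
  | _, _, _, .eqMp φ ψ d1 d2 => φ.tvLt n ∧ ψ.tvLt n ∧ HDeriv.tvLt n d1 ∧ HDeriv.tvLt n d2
  | _, _, _, .deductAntiSym φ ψ d1 d2 =>
      φ.tvLt n ∧ ψ.tvLt n ∧ HDeriv.tvLt n d1 ∧ HDeriv.tvLt n d2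
  | _, _, _, .typeSubst θ d => (∀ A ∈ θ, A.tvLt n) ∧ HDeriv.tvLt (max θ.length n) d
  | _, _, _, .termSubst σ _ _ d => (∀ t ∈ σ, t.tvLt n) ∧ HDeriv.tvLt n d

/-! ### Renaming and substitution -/

namespace DTm

/-- Lift a renaming under one binder. -/
def liftRen (ξ : ℕ → ℕ) : ℕ → ℕ
  | 0 => 0
  | n+1 => ξ n + 1

/-- Simultaneous renaming. -/
def ren (ξ : ℕ → ℕ) : DTm → DTm
  | var n => var (ξ n)
  | const k => const k
  | type => type
  | kind => kind
  | pi A B => pi (ren ξ A) (ren (liftRen ξ) B)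
  | lam A M => lam (ren ξ A) (ren (liftRen ξ) M)
  | app M N => app (ren ξ M) (ren ξ N)

/-- Extend a substitution with an image for the index `0`. -/
def scons (N : DTm) (σ : ℕ → DTm) : ℕ → DTm
  | 0 => N
  | n+1 => σ n

theorem shift_eq_ren (d c : ℕ) (M : DTm) :
    shift d c M = ren (fun n => if n < c then n else n + d) M := by
  have lift_eq : ∀ c : ℕ, liftRen (fun n => if n < c then n else n + d) =
      fun n => if n < c + 1 then n else n + d := by
    intro c
    funext n
    cases n with
    | zero => simp [liftRen]
    | succ n => simp only [liftRen, Nat.add_lt_add_iff_right]; split <;> omega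
  induction M generalizing c with
  | var n => simp only [shift, ren]; split <;> rfl
  | const k => rfl
  | type => rfl
  | kind => rfl
  | pi A B ihA ihB => simp only [shift, ren, ihA, ihB, lift_eq]
  | lam A B ihA ihB => simp only [shift, ren, ihA, ihB, lift_eq]
  | app A B ihA ihB => simp only [shift, ren, ihA, ihB]

theorem shift_zero_eq_ren (d : ℕ) (M : DTm) : shift d 0 M = ren (· + d) M := by
  simp [shift_eq_ren]

theorem ren_ren (ξ ζ : ℕ → ℕ) (M : DTm) : ren ζ (ren ξ M) = ren (ζ ∘ ξ) M := by
  have lift_comp : ∀ ξ ζ : ℕ → ℕ, liftRen ζ ∘ liftRen ξ = liftRen (ζ ∘ ξ) := by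
    intro ξ ζ
    funext n
    cases n <;> rfl
  induction M generalizing ξ ζ <;> simp_all [ren]

theorem subst_ren (ξ : ℕ → ℕ) (σ : ℕ → DTm) (M : DTm) :
    subst σ (ren ξ M) = subst (σ ∘ ξ) M := by
  have lift_comp : ∀ (ξ : ℕ → ℕ) (σ : ℕ → DTm),
      liftSub σ ∘ liftRen ξ = liftSub (σ ∘ ξ) := by
    intro ξ σ
    funext n
    cases n <;> rfl
  induction M generalizing ξ σ <;> simp_all [ren, subst]

theorem ren_subst (ξ : ℕ → ℕ) (σ : ℕ → DTm) (M : DTm) :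
    ren ξ (subst σ M) = subst (ren ξ ∘ σ) M := by
  have lift_comp : ∀ (ξ : ℕ → ℕ) (σ : ℕ → DTm),
      ren (liftRen ξ) ∘ liftSub σ = liftSub (ren ξ ∘ σ) := by
    intro ξ σ
    funext n
    cases n with
    | zero => rfl
    | succ n => simp only [Function.comp, liftSub, shift_zero_eq_ren, ren_ren]; rfl
  induction M generalizing ξ σ <;> simp_all [ren, subst]

theorem subst_subst (σ τ : ℕ → DTm) (M : DTm) :
    subst τ (subst σ M) = subst (fun n => subst τ (σ n)) M := by
  have lift_comp : ∀ σ τ : ℕ → DTm,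
      (fun n => subst (liftSub τ) (liftSub σ n)) = liftSub (fun n => subst τ (σ n)) := by
    intro σ τ
    funext n
    cases n with
    | zero => rfl
    | succ n =>
      simp only [liftSub, shift_zero_eq_ren, subst_ren, ren_subst]
      congr 1
      funext k
      simp [liftSub, shift_zero_eq_ren]
  induction M generalizing σ τ <;> simp_all [subst]

theorem subst_var (M : DTm) : subst var M = M := by
  have lift_var : liftSub var = var := by
    funext n
    cases n <;> simp [liftSub, shift]
  induction M <;> simp_all [subst]

theorem ren_eq_subst (ξ : ℕ → ℕ) (M : DTm) : ren ξ M = subst (fun n => var (ξ n)) M := by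
  rw [← subst_var (ren ξ M), subst_ren]
  rfl

theorem subst0_eq (M N : DTm) : subst0 M N = subst (scons N var) M := rfl

theorem shift_subst_liftSub (σ : ℕ → DTm) (M : DTm) :
    (shift 1 0 M).subst (liftSub σ) = shift 1 0 (M.subst σ) := by
  simp only [shift_zero_eq_ren, subst_ren, ren_subst]
  congr 1
  funext n
  simp [liftSub, shift_zero_eq_ren]

theorem shift_subst_scons (d : ℕ) (N : DTm) (σ : ℕ → DTm) (M : DTm) :
    (shift (d+1) 0 M).subst (scons N σ) = (shift d 0 M).subst σ := by
  simp only [shift_zero_eq_ren, subst_ren]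
  rfl

theorem shift_zero (M : DTm) : shift 0 0 M = M := by
  rw [shift_zero_eq_ren, ren_eq_subst]
  exact subst_var M

theorem shift_subst0 (M N : DTm) : (shift 1 0 M).subst0 N = M := by
  rw [subst0_eq, shift_subst_scons, shift_zero, subst_var]

theorem subst_liftSub_subst0 (σ : ℕ → DTm) (M N : DTm) :
    (M.subst (liftSub σ)).subst0 N = M.subst (scons N σ) := by
  rw [subst0_eq, subst_subst]
  congr 1
  funext n
  cases n with
  | zero => rfl
  | succ n => rw [liftSub, ← subst0_eq, shift_subst0]; rfl

theorem subst_subst0 (σ : ℕ → DTm) (M N : DTm) :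
    (M.subst0 N).subst σ = (M.subst (liftSub σ)).subst0 (N.subst σ) := by
  rw [subst_liftSub_subst0, subst0_eq, subst_subst]
  congr 1
  funext n
  cases n <;> rfl

end DTm

/-! ### One-step reduction of the HOL signature -/

/-- An explicit presentation of `→βΣ` for the signature `holSig`. -/
inductive Step : DTm → DTm → Prop
  | beta (A M N) : Step (.app (.lam A M) N) (M.subst0 N)
  | rule (a b) : Step (tTerm (tArr a b)) (DTm.arr (tTerm a) (tTerm b))
  | appL {M M'} (N) : Step M M' → Step (.app M N) (.app M' N)
  | appR (M) {N N'} : Step N N' → Step (.app M N) (.app M N')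
  | lamTy {A A'} (M) : Step A A' → Step (.lam A M) (.lam A' M)
  | lamBody (A) {M M'} : Step M M' → Step (.lam A M) (.lam A M')
  | piL {A A'} (B) : Step A A' → Step (.pi A B) (.pi A' B)
  | piR (A) {B B'} : Step B B' → Step (.pi A B) (.pi A B')

theorem Red.step {M N : DTm} (h : Red holSig M N) : Step M N := by
  induction h with
  | beta A M N => exact .beta A M N
  | @rew G L R σ h =>
    obtain ⟨-, rfl, rfl⟩ : G = arrowRuleCtx ∧ L = arrowRuleL ∧ R = arrowRuleR := by
      simpa [holSig, baseSig, Sig.hasRule] using h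
    exact .rule (σ 1) (σ 0)
  | appL N _ ih => exact .appL N ih
  | appR M _ ih => exact .appR M ih
  | lamTy M _ ih => exact .lamTy M ih
  | lamBody A _ ih => exact .lamBody A ih
  | piL B _ ih => exact .piL B ih
  | piR A _ ih => exact .piR A ih

theorem Step.subst {M N : DTm} (h : Step M N) (σ : ℕ → DTm) :
    Step (M.subst σ) (N.subst σ) := by
  induction h generalizing σ with
  | beta A M N => rw [DTm.subst_subst0]; exact .beta _ _ _
  | rule a b =>
    simp only [tTerm, tArr, DTm.arr, DTm.subst, DTm.shift, DTm.shift_subst_liftSub]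
    exact .rule _ _
  | appL N _ ih => exact .appL _ (ih σ)
  | appR M _ ih => exact .appR _ (ih σ)
  | lamTy M _ ih => exact .lamTy _ (ih σ)
  | lamBody A _ ih => exact .lamBody _ (ih _)
  | piL B _ ih => exact .piL _ (ih σ)
  | piR A _ ih => exact .piR _ (ih _)

/-- Many-step reduction. -/
abbrev Steps : DTm → DTm → Prop := Relation.ReflTransGen Step

namespace Steps

theorem app {M M' N N' : DTm} (h : Steps M M') (h' : Steps N N') :
    Steps (.app M N) (.app M' N') :=
  (h.lift (DTm.app · N) fun _ _ s => Step.appL N s).trans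
    (h'.lift (DTm.app M' ·) fun _ _ s => Step.appR M' s)

theorem lam {M M' N N' : DTm} (h : Steps M M') (h' : Steps N N') :
    Steps (.lam M N) (.lam M' N') :=
  (h.lift (DTm.lam · N) fun _ _ s => Step.lamTy N s).trans
    (h'.lift (DTm.lam M' ·) fun _ _ s => Step.lamBody M' s)

theorem pi {M M' N N' : DTm} (h : Steps M M') (h' : Steps N N') :
    Steps (.pi M N) (.pi M' N') :=
  (h.lift (DTm.pi · N) fun _ _ s => Step.piL N s).trans
    (h'.lift (DTm.pi M' ·) fun _ _ s => Step.piR M' s)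

theorem subst {M N : DTm} (h : Steps M N) (σ : ℕ → DTm) :
    Steps (M.subst σ) (N.subst σ) :=
  h.lift (DTm.subst σ) fun _ _ s => s.subst σ

theorem subst0_left {M M' : DTm} (h : Steps M M') (N : DTm) :
    Steps (M.subst0 N) (M'.subst0 N) := h.subst _

theorem shift {M N : DTm} (h : Steps M N) (d c : ℕ) :
    Steps (M.shift d c) (N.shift d c) := by
  simp only [DTm.shift_eq_ren, DTm.ren_eq_subst]
  exact h.subst _

theorem subst_pointwise (M : DTm) {σ τ : ℕ → DTm} (h : ∀ n, Steps (σ n) (τ n)) :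
    Steps (M.subst σ) (M.subst τ) := by
  have lift : ∀ {σ τ : ℕ → DTm}, (∀ n, Steps (σ n) (τ n)) →
      ∀ n, Steps (DTm.liftSub σ n) (DTm.liftSub τ n) := by
    intro σ τ h n
    cases n with
    | zero => exact .refl
    | succ n => exact (h n).shift 1 0
  induction M generalizing σ τ with
  | var n => exact h n
  | const k => exact .refl
  | type => exact .refl
  | kind => exact .refl
  | pi A B ihA ihB => exact (ihA h).pi (ihB (lift h))
  | lam A B ihA ihB => exact (ihA h).lam (ihB (lift h))
  | app A B ihA ihB => exact (ihA h).app (ihB h)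

theorem subst0_right (M : DTm) {N N' : DTm} (h : Steps N N') :
    Steps (M.subst0 N) (M.subst0 N') := by
  refine subst_pointwise M fun n => ?_
  cases n with
  | zero => exact h
  | succ n => exact .refl

theorem pi_inv {A B X : DTm} (h : Steps (.pi A B) X) :
    ∃ A' B', X = .pi A' B' ∧ Steps A A' ∧ Steps B B' := by
  induction h with
  | refl => exact ⟨A, B, rfl, .refl, .refl⟩
  | tail _ s ih =>
    obtain ⟨A', B', rfl, hA, hB⟩ := ih
    cases s with
    | piL _ s => exact ⟨_, _, rfl, hA.tail s, hB⟩
    | piR _ s => exact ⟨_, _, rfl, hA, hB.tail s⟩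

theorem eq_of_normal {M X : DTm} (hM : ∀ N, ¬ Step M N) (h : Steps M X) : X = M := by
  rcases h.cases_head with rfl | ⟨N, s, _⟩
  · rfl
  · exact (hM N s).elim

end Steps

/-! ### Confluence -/

/-- Parallel reduction. -/
inductive Par : DTm → DTm → Prop
  | var (n) : Par (.var n) (.var n)
  | const (k) : Par (.const k) (.const k)
  | type : Par .type .type
  | kind : Par .kind .kind
  | pi {A A' B B'} : Par A A' → Par B B' → Par (.pi A B) (.pi A' B')
  | lam {A A' M M'} : Par A A' → Par M M' → Par (.lam A M) (.lam A' M')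
  | app {M M' N N'} : Par M M' → Par N N' → Par (.app M N) (.app M' N')
  | beta (A) {M M' N N'} : Par M M' → Par N N' →
      Par (.app (.lam A M) N) (M'.subst0 N')
  | rule {a a' b b'} : Par a a' → Par b b' →
      Par (tTerm (tArr a b)) (DTm.arr (tTerm a') (tTerm b'))

namespace Par

theorem refl (M : DTm) : Par M M := by
  induction M with
  | var n => exact .var n
  | const k => exact .const k
  | type => exact .type
  | kind => exact .kind
  | pi A B ihA ihB => exact .pi ihA ihB
  | lam A B ihA ihB => exact .lam ihA ihB
  | app A B ihA ihB => exact .app ihA ihB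

theorem of_step {M N : DTm} (h : Step M N) : Par M N := by
  induction h with
  | beta A M N => exact .beta A (.refl _) (.refl _)
  | rule a b => exact .rule (.refl _) (.refl _)
  | appL N _ ih => exact .app ih (.refl _)
  | appR M _ ih => exact .app (.refl _) ih
  | lamTy M _ ih => exact .lam ih (.refl _)
  | lamBody A _ ih => exact .lam (.refl _) ih
  | piL B _ ih => exact .pi ih (.refl _)
  | piR A _ ih => exact .pi (.refl _) ih

theorem steps {M N : DTm} (h : Par M N) : Steps M N := by
  induction h with
  | var n => exact .refl
  | const k => exact .refl
  | type => exact .refl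
  | kind => exact .refl
  | pi _ _ ihA ihB => exact ihA.pi ihB
  | lam _ _ ihA ihB => exact ihA.lam ihB
  | app _ _ ihA ihB => exact ihA.app ihB
  | beta A _ _ ihM ihN =>
    exact .head (.beta _ _ _) ((ihM.subst0_left _).trans (Steps.subst0_right _ ihN))
  | rule _ _ iha ihb =>
    exact .head (.rule _ _) ((Steps.app .refl iha).pi ((Steps.app .refl ihb).shift 1 0))

theorem subst_left {M N : DTm} (h : Par M N) (σ : ℕ → DTm) :
    Par (M.subst σ) (N.subst σ) := by
  induction h generalizing σ with
  | var n => exact .refl _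
  | const k => exact .refl _
  | type => exact .refl _
  | kind => exact .refl _
  | pi _ _ ihA ihB => exact .pi (ihA _) (ihB _)
  | lam _ _ ihA ihB => exact .lam (ihA _) (ihB _)
  | app _ _ ihA ihB => exact .app (ihA _) (ihB _)
  | beta A _ _ ihM ihN => rw [DTm.subst_subst0]; exact .beta _ (ihM _) (ihN _)
  | rule _ _ iha ihb =>
    simp only [tTerm, tArr, DTm.arr, DTm.subst, DTm.shift, DTm.shift_subst_liftSub]
    exact .rule (iha _) (ihb _)

theorem shift {M N : DTm} (h : Par M N) (d c : ℕ) : Par (M.shift d c) (N.shift d c) := by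
  simp only [DTm.shift_eq_ren, DTm.ren_eq_subst]
  exact h.subst_left _

theorem subst {M N : DTm} (h : Par M N) {σ τ : ℕ → DTm} (hs : ∀ n, Par (σ n) (τ n)) :
    Par (M.subst σ) (N.subst τ) := by
  have lift : ∀ {σ τ : ℕ → DTm}, (∀ n, Par (σ n) (τ n)) →
      ∀ n, Par (DTm.liftSub σ n) (DTm.liftSub τ n) := by
    intro σ τ h n
    cases n with
    | zero => exact .refl _
    | succ n => exact (h n).shift 1 0
  induction h generalizing σ τ with
  | var n => exact hs n
  | const k => exact .refl _
  | type => exact .refl _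
  | kind => exact .refl _
  | pi _ _ ihA ihB => exact .pi (ihA hs) (ihB (lift hs))
  | lam _ _ ihA ihB => exact .lam (ihA hs) (ihB (lift hs))
  | app _ _ ihA ihB => exact .app (ihA hs) (ihB hs)
  | beta A _ _ ihM ihN => rw [DTm.subst_subst0]; exact .beta _ (ihM (lift hs)) (ihN hs)
  | rule _ _ iha ihb =>
    simp only [tTerm, tArr, DTm.arr, DTm.subst, DTm.shift, DTm.shift_subst_liftSub]
    exact .rule (iha hs) (ihb hs)

theorem subst0 {M M' N N' : DTm} (h : Par M M') (h' : Par N N') :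
    Par (M.subst0 N) (M'.subst0 N') := by
  refine h.subst fun n => ?_
  cases n with
  | zero => exact h'
  | succ n => exact .refl _

theorem tArr_inv {a b X : DTm} (h : Par (tArr a b) X) :
    ∃ a' b', X = tArr a' b' ∧ Par a a' ∧ Par b b' := by
  cases h with
  | app h hb =>
    cases h with
    | app h ha => cases h; exact ⟨_, _, rfl, ha, hb⟩

theorem diamond {M N N' : DTm} (h : Par M N) (h' : Par M N') :
    ∃ X, Par N X ∧ Par N' X := by
  induction h generalizing N' with
  | var n => exact ⟨N', h', .refl _⟩
  | const k => exact ⟨N', h', .refl _⟩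
  | type => exact ⟨N', h', .refl _⟩
  | kind => exact ⟨N', h', .refl _⟩
  | pi _ _ ihA ihB =>
    cases h' with
    | pi hA hB =>
      obtain ⟨X, hX, hX'⟩ := ihA hA
      obtain ⟨Y, hY, hY'⟩ := ihB hB
      exact ⟨_, .pi hX hY, .pi hX' hY'⟩
  | lam _ _ ihA ihB =>
    cases h' with
    | lam hA hB =>
      obtain ⟨X, hX, hX'⟩ := ihA hA
      obtain ⟨Y, hY, hY'⟩ := ihB hB
      exact ⟨_, .lam hX hY, .lam hX' hY'⟩
  | @app M M₁ N N₁ hM hN ihM ihN =>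
    cases h' with
    | app hM' hN' =>
      obtain ⟨X, hX, hX'⟩ := ihM hM'
      obtain ⟨Y, hY, hY'⟩ := ihN hN'
      exact ⟨_, .app hX hY, .app hX' hY'⟩
    | @beta A P P' _ _ hP hN' =>
      obtain ⟨Y, hY, hY'⟩ := ihN hN'
      obtain ⟨X, hX, hX'⟩ := ihM (.lam (.refl A) hP)
      cases hM with
      | lam _ _ =>
        cases hX with
        | lam _ hX =>
          cases hX' with
          | lam _ hX' => exact ⟨_, .beta _ hX hY, hX'.subst0 hY'⟩
    | rule ha hb =>
      obtain ⟨Y, hY, hY'⟩ := ihN (.app (.app (.refl _) ha) hb)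
      cases hM
      obtain ⟨p, q, rfl, hp, hq⟩ := tArr_inv hY'
      obtain ⟨a₁, b₁, rfl, -, -⟩ := tArr_inv hN
      obtain ⟨_, _, e, hp', hq'⟩ := tArr_inv hY
      cases e
      exact ⟨_, .rule hp' hq', .pi (.app (.refl _) hp) ((Par.app (.refl _) hq).shift 1 0)⟩
  | beta A hP hN ihP ihN =>
    cases h' with
    | app hM hN' =>
      cases hM with
      | lam _ hP' =>
        obtain ⟨X, hX, hX'⟩ := ihP hP'
        obtain ⟨Y, hY, hY'⟩ := ihN hN'
        exact ⟨_, hX.subst0 hY, .beta _ hX' hY'⟩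
    | beta _ hP' hN' =>
      obtain ⟨X, hX, hX'⟩ := ihP hP'
      obtain ⟨Y, hY, hY'⟩ := ihN hN'
      exact ⟨_, hX.subst0 hY, hX'.subst0 hY'⟩
  | rule ha hb iha ihb =>
    have join : ∀ {a b a' b' : DTm}, Par a a' → Par b b' →
        Par (DTm.arr (tTerm a) (tTerm b)) (DTm.arr (tTerm a') (tTerm b')) :=
      fun ha hb => .pi (.app (.refl _) ha) ((Par.app (.refl _) hb).shift 1 0)
    cases h' with
    | app hM hN =>
      cases hM
      obtain ⟨a', b', rfl, ha', hb'⟩ := tArr_inv hN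
      obtain ⟨X, hX, hX'⟩ := iha ha'
      obtain ⟨Y, hY, hY'⟩ := ihb hb'
      exact ⟨_, join hX hY, .rule hX' hY'⟩
    | rule ha' hb' =>
      obtain ⟨X, hX, hX'⟩ := iha ha'
      obtain ⟨Y, hY, hY'⟩ := ihb hb'
      exact ⟨_, join hX hY, join hX' hY'⟩

end Par

theorem Steps.confluent {M N N' : DTm} (h : Steps M N) (h' : Steps M N') :
    ∃ X, Steps N X ∧ Steps N' X := by
  have toPar : ∀ {M N : DTm}, Steps M N → Relation.ReflTransGen Par M N :=
    fun h => Relation.ReflTransGen.mono (fun _ _ s => Par.of_step s) _ _ h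
  have ofPar : ∀ {M N : DTm}, Relation.ReflTransGen Par M N → Steps M N := by
    intro M N h
    induction h with
    | refl => exact .refl
    | tail _ p ih => exact ih.trans p.steps
  obtain ⟨X, hX, hX'⟩ := Relation.church_rosser (r := Par) (fun a b c hb hc => by
    obtain ⟨d, hd, hd'⟩ := hb.diamond hc
    exact ⟨d, .single hd, .single hd'⟩) (toPar h) (toPar h')
  exact ⟨X, ofPar hX, ofPar hX'⟩

theorem Conv.join {M N : DTm} (h : Conv holSig M N) : ∃ X, Steps M X ∧ Steps N X := by
  induction h with
  | rel M N h => exact ⟨N, .single h.step, .refl⟩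
  | refl M => exact ⟨M, .refl, .refl⟩
  | symm M N _ ih => exact ih.imp fun _ h => h.symm
  | trans M N P _ _ ih ih' =>
    obtain ⟨X, hX, hX'⟩ := ih
    obtain ⟨Y, hY, hY'⟩ := ih'
    obtain ⟨Z, hZ, hZ'⟩ := hX'.confluent hY
    exact ⟨Z, hX.trans hZ, hY'.trans hZ'⟩

/-! ### Strong normalization and reducibility candidates -/

/-- Strong normalization for `Step`. -/
abbrev SN (M : DTm) : Prop := Acc (fun x y => Step y x) M

theorem SN.of_map {f : DTm → DTm} (hf : ∀ {M N}, Step M N → Step (f M) (f N)) {M : DTm}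
    (h : SN (f M)) : SN M := by
  generalize e : f M = X at h
  induction h generalizing M with
  | intro X _ ih => exact ⟨_, fun N s => ih (f N) (e ▸ hf s) rfl⟩

theorem SN.of_subst {M : DTm} {σ : ℕ → DTm} (h : SN (M.subst σ)) : SN M :=
  h.of_map fun s => s.subst σ

theorem SN.appL {M N : DTm} (h : SN (.app M N)) : SN M := h.of_map fun s => .appL N s

theorem SN.shift_one {M : DTm} (h : SN M) : SN (M.shift 1 0) := by
  rw [← DTm.shift_subst0 M .type] at h
  exact h.of_subst

theorem SN.of_normal {M : DTm} (hM : ∀ N, ¬ Step M N) : SN M :=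
  ⟨_, fun N s => (hM N s).elim⟩

theorem SN.pi {A B : DTm} (hA : SN A) (hB : SN B) : SN (.pi A B) := by
  induction hA generalizing B with
  | intro A hA ihA =>
    induction hB with
    | intro B hB ihB =>
      refine ⟨_, fun X s => ?_⟩
      cases s with
      | piL _ s => exact ihA _ s ⟨_, hB⟩
      | piR _ s => exact ihB _ s

/-- Terms whose application to an argument is never a redex at the root, and which
are not values of a universe. -/
def Neutral : DTm → Prop
  | .var _ => True
  | .const k => k ≠ 4
  | .app _ _ => True
  | _ => False

/-- Reducibility candidates. -/
structure Cand (P : DTm → Prop) : Prop where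
  sn : ∀ {M}, P M → SN M
  step : ∀ {M N}, P M → Step M N → P N
  neutral : ∀ {M}, Neutral M → (∀ N, Step M N → P N) → P M

namespace Cand

theorem steps {P : DTm → Prop} (hP : Cand P) {M N : DTm} (h : P M) (s : Steps M N) : P N := by
  induction s with
  | refl => exact h
  | tail _ s ih => exact hP.step ih s

theorem const {P : DTm → Prop} (hP : Cand P) {k : ℕ} (hk : k ≠ 4) : P (.const k) :=
  hP.neutral hk fun _ s => nomatch s

theorem ofSN : Cand SN :=
  ⟨id, fun h s => h.inv s, fun _ h => ⟨_, h⟩⟩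

theorem pi {Q : DTm → Prop} {F : DTm → DTm → Prop} (hQ : Cand Q)
    (hF : ∀ N, Q N → Cand (F N)) (hstep : ∀ N N', Q N → Step N N' → F N = F N') :
    Cand fun M => ∀ N, Q N → F N (.app M N) where
  sn h := ((hF _ (hQ.const (k := 0) (by decide))).sn
    (h _ (hQ.const (by decide)))).appL
  step h s N hN := (hF N hN).step (h N hN) (.appL N s)
  neutral {M} hM h N hN := by
    have snN := hQ.sn hN
    induction snN with
    | intro N _ ih =>
      refine (hF N hN).neutral trivial fun X s => ?_
      cases s with
      | beta A B _ => exact hM.elim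
      | rule a b => exact (hM rfl).elim
      | appL _ s => exact h _ s N hN
      | appR _ s => rw [hstep N _ hN s]; exact ih _ s (hQ.step hN s)

theorem lam_app {P : DTm → Prop} (hP : Cand P) {A M N : DTm} (hA : SN A) (hM : SN M)
    (hN : SN N) (h : P (M.subst0 N)) : P (.app (.lam A M) N) := by
  induction hA generalizing M N with
  | intro A hA ihA =>
    induction hM generalizing N with
    | intro M hM ihM =>
      induction hN with
      | intro N hN ihN =>
        refine hP.neutral trivial fun X s => ?_
        cases s with
        | beta => exact h
        | appL _ s =>
          cases s with
          | lamTy _ s => exact ihA _ s ⟨_, hM⟩ ⟨_, hN⟩ h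
          | lamBody _ s => exact ihM _ s ⟨_, hN⟩ (hP.step h (s.subst _))
        | appR _ s => exact ihN _ s (hP.steps h (Steps.subst0_right M (.single s)))

end Cand

/-! ### Interpretation of types

`Interp U A P` says that `A` is a reducible type whose elements are those of `P`; the
parameter `U` lists the universes that are available, with their elements. -/

/-- Reducible types and their interpretations. -/
inductive Interp (U : DTm → (DTm → Prop) → Prop) : DTm → (DTm → Prop) → Prop
  | pi {A B C : DTm} {Q : DTm → Prop} {F : DTm → DTm → Prop} :
      Steps A (.pi B C) → Interp U B Q → (∀ N, Q N → Interp U (C.subst0 N) (F N)) →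
      Interp U A fun M => ∀ N, Q N → F N (.app M N)
  | univ {A s : DTm} {P : DTm → Prop} : Steps A s → U s P → Interp U A P
  | base {A : DTm} : (∀ B C, ¬ Steps A (.pi B C)) → ¬ Steps A .type → ¬ Steps A .kind →
      Interp U A SN

/-- The strongly normalizing reducible types. -/
def Types (U : DTm → (DTm → Prop) → Prop) (A : DTm) : Prop := SN A ∧ ∃ P, Interp U A P

/-- The condition that `U` interprets only the sorts, by reducibility candidates. -/
structure IsUniv (U : DTm → (DTm → Prop) → Prop) : Prop where
  sort : ∀ {s P}, U s P → s = .type ∨ s = .kind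
  unique : ∀ {s P P'}, U s P → U s P' → P = P'
  cand : ∀ {s P}, U s P → Cand P

theorem step_type_absurd (N : DTm) : ¬ Step .type N := fun s => nomatch s

theorem step_kind_absurd (N : DTm) : ¬ Step .kind N := fun s => nomatch s

theorem IsUniv.normal {U : DTm → (DTm → Prop) → Prop} (hU : IsUniv U) {s : DTm}
    {P : DTm → Prop} (h : U s P) (N : DTm) : ¬ Step s N := by
  rcases hU.sort h with rfl | rfl
  · exact step_type_absurd N
  · exact step_kind_absurd N

theorem Steps.to_normal {M N X : DTm} (hX : ∀ N, ¬ Step X N) (h : Steps M X)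
    (s : Steps M N) : Steps N X := by
  obtain ⟨Y, hY, hY'⟩ := h.confluent s
  rwa [eq_of_normal hX hY] at hY'

namespace Interp

variable {U : DTm → (DTm → Prop) → Prop}

theorem mono {U' : DTm → (DTm → Prop) → Prop} (hU : ∀ s P, U s P → U' s P) {A : DTm}
    {P : DTm → Prop} (h : Interp U A P) : Interp U' A P := by
  induction h with
  | pi s _ _ ihB ihC => exact .pi s ihB ihC
  | univ s h => exact .univ s (hU _ _ h)
  | base h₁ h₂ h₃ => exact .base h₁ h₂ h₃

theorem expand {A A' : DTm} {P : DTm → Prop} (s : Steps A A') (h : Interp U A' P) :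
    Interp U A P := by
  cases h with
  | pi s' hB hC => exact .pi (s.trans s') hB hC
  | univ s' h => exact .univ (s.trans s') h
  | base h₁ h₂ h₃ =>
    refine .base (fun B C s' => ?_) (fun s' => h₂ ?_) (fun s' => h₃ ?_)
    · obtain ⟨X, hX, hX'⟩ := s.confluent s'
      obtain ⟨B', C', rfl, -, -⟩ := hX'.pi_inv
      exact h₁ _ _ hX
    · exact s'.to_normal step_type_absurd s
    · exact s'.to_normal step_kind_absurd s

theorem reduce (hU : IsUniv U) {A A' : DTm} {P : DTm → Prop} (h : Interp U A P)
    (s : Steps A A') : Interp U A' P := by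
  induction h generalizing A' with
  | pi s' _ _ ihB ihC =>
    obtain ⟨X, hX, hX'⟩ := s.confluent s'
    obtain ⟨B', C', rfl, hB, hC⟩ := hX'.pi_inv
    exact .pi hX (ihB hB) fun N hN => ihC N hN (hC.subst0_left N)
  | univ s' h => exact .univ (s'.to_normal (hU.normal h) s) h
  | base h₁ h₂ h₃ =>
    exact .base (fun B C hs => h₁ B C (s.trans hs)) (fun hs => h₂ (s.trans hs))
      (fun hs => h₃ (s.trans hs))

/-- Inversion for the interpretation of products. -/
theorem pi_inv (hU : IsUniv U) {A B C : DTm} {P : DTm → Prop} (h : Interp U A P)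
    (s : Steps A (.pi B C)) : ∃ (Q : DTm → Prop) (F : DTm → DTm → Prop), Interp U B Q ∧
      (∀ N, Q N → Interp U (C.subst0 N) (F N)) ∧ P = fun M => ∀ N, Q N → F N (.app M N) := by
  cases h with
  | pi s' hB hC =>
    obtain ⟨X, hX, hX'⟩ := s.confluent s'
    obtain ⟨B', C', rfl, hB₁, hC₁⟩ := hX.pi_inv
    obtain ⟨_, _, e, hB₂, hC₂⟩ := hX'.pi_inv
    cases e
    exact ⟨_, _, (hB.reduce hU hB₂).expand hB₁,
      fun N hN => ((hC N hN).reduce hU (hC₂.subst0_left N)).expand (hC₁.subst0_left N), rfl⟩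
  | univ s' h =>
    obtain ⟨_, _, rfl, -, -⟩ := (s'.to_normal (hU.normal h) s).pi_inv
    rcases hU.sort h with e | e <;> cases e
  | base h₁ => exact (h₁ _ _ s).elim

theorem univ_inv (hU : IsUniv U) {A s : DTm} {P P' : DTm → Prop} (h : Interp U A P)
    (hs : Steps A s) (hP' : U s P') : P = P' := by
  cases h with
  | pi s' _ _ =>
    obtain ⟨_, _, rfl, -, -⟩ := (hs.to_normal (hU.normal hP') s').pi_inv
    rcases hU.sort hP' with e | e <;> cases e
  | univ s' h =>
    obtain rfl := Steps.eq_of_normal (hU.normal hP') (s'.to_normal (hU.normal h) hs)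
    exact hU.unique h hP'
  | base _ h₂ h₃ =>
    rcases hU.sort hP' with rfl | rfl
    · exact (h₂ hs).elim
    · exact (h₃ hs).elim

theorem unique (hU : IsUniv U) {A : DTm} {P P' : DTm → Prop} (h : Interp U A P)
    (h' : Interp U A P') : P = P' := by
  induction h generalizing P' with
  | pi s _ _ ihB ihC =>
    obtain ⟨Q, F, hB, hC, rfl⟩ := h'.pi_inv hU s
    obtain rfl := ihB hB
    funext M
    exact propext (forall₂_congr fun N hN => by rw [ihC N hN (hC N hN)])
  | univ s h => exact (h'.univ_inv hU s h).symm
  | base h₁ h₂ h₃ =>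
    cases h' with
    | pi s => exact (h₁ _ _ s).elim
    | univ s h =>
      rcases hU.sort h with rfl | rfl
      · exact (h₂ s).elim
      · exact (h₃ s).elim
    | base => rfl

theorem cand (hU : IsUniv U) {A : DTm} {P : DTm → Prop} (h : Interp U A P) : Cand P := by
  induction h with
  | @pi A B C Q F s _ hC ihB ihC =>
    refine .pi ihB ihC fun N N' hN s => ?_
    exact ((hC N hN).reduce hU (Steps.subst0_right C (.single s))).unique hU
      (hC N' (ihB.step hN s))
  | univ _ h => exact hU.cand h
  | base => exact .ofSN

theorem types_cand (hU : IsUniv U) : Cand (Types U) where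
  sn h := h.1
  step := fun ⟨h, P, hP⟩ s => ⟨h.inv s, P, hP.reduce hU (.single s)⟩
  neutral {A} hA h := by
    refine ⟨⟨_, fun N s => (h N s).1⟩, ?_⟩
    by_cases hn : ∃ N, Step A N
    · obtain ⟨N, s⟩ := hn
      obtain ⟨P, hP⟩ := (h N s).2
      exact ⟨P, hP.expand (.single s)⟩
    · have normal : ∀ N, ¬ Step A N := fun N s => hn ⟨N, s⟩
      refine ⟨_, .base (fun B C s => ?_) (fun s => ?_) (fun s => ?_)⟩ <;>
      · have e := Steps.eq_of_normal normal s
        subst e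
        exact hA

end Interp

/-! ### The universes -/

/-- Small types: no universe. -/
def U₀ : DTm → (DTm → Prop) → Prop := fun _ _ => False

/-- Kinds: `Type` is the universe of small types. -/
def U₁ : DTm → (DTm → Prop) → Prop := fun s P => s = .type ∧ P = Types U₀

/-- `Kind` is the universe of kinds. -/
def U₂ : DTm → (DTm → Prop) → Prop :=
  fun s P => U₁ s P ∨ (s = .kind ∧ P = Types U₁)

theorem isUniv_U₀ : IsUniv U₀ := ⟨False.elim, False.elim, False.elim⟩

theorem isUniv_U₁ : IsUniv U₁ where
  sort h := .inl h.1
  unique h h' := h.2.trans h'.2.symm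
  cand h := h.2 ▸ Interp.types_cand isUniv_U₀

theorem isUniv_U₂ : IsUniv U₂ where
  sort := fun h => h.imp And.left And.left
  unique := by
    rintro s P P' (⟨rfl, rfl⟩ | ⟨rfl, rfl⟩) (⟨e, rfl⟩ | ⟨e, rfl⟩) <;> first | rfl | cases e
  cand := by
    rintro s P (h | ⟨rfl, rfl⟩)
    · exact isUniv_U₁.cand h
    · exact Interp.types_cand isUniv_U₁

theorem Interp.U₀_le {A : DTm} {P : DTm → Prop} (h : Interp U₀ A P) : Interp U₁ A P :=
  h.mono fun _ _ h => h.elim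

theorem Interp.U₁_le {A : DTm} {P : DTm → Prop} (h : Interp U₁ A P) : Interp U₂ A P :=
  h.mono fun _ _ h => .inl h

/-! ### The type constructor `term` -/

theorem interp_cTy {U : DTm → (DTm → Prop) → Prop} : Interp U cTy SN := by
  have normal : ∀ N, ¬ Step cTy N := fun N s => nomatch s
  refine .base (fun B C s => ?_) (fun s => ?_) (fun s => ?_) <;>
    cases Steps.eq_of_normal normal s

/-- `N` is `M` or a side of `M` reached through `arrow`s only. -/
inductive ArrowPart : DTm → DTm → Prop
  | refl (M) : ArrowPart M M
  | left {M a b} : ArrowPart M (tArr a b) → ArrowPart M a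
  | right {M a b} : ArrowPart M (tArr a b) → ArrowPart M b

theorem ArrowPart.step {M N N' : DTm} (h : ArrowPart M N) (s : Step N N') :
    ∃ M', Step M M' ∧ ArrowPart M' N' := by
  induction h generalizing N' with
  | refl => exact ⟨_, s, .refl _⟩
  | left _ ih =>
    obtain ⟨M', s', h⟩ := ih (.appL _ (.appR _ s))
    exact ⟨M', s', h.left⟩
  | right _ ih =>
    obtain ⟨M', s', h⟩ := ih (.appR _ s)
    exact ⟨M', s', h.right⟩

theorem types_term {N : DTm} (hN : SN N) : Types U₀ (tTerm N) := by
  suffices ∀ M, SN M → ∀ N, ArrowPart M N → Types U₀ (tTerm N) from this N hN N (.refl N)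
  intro M hM
  induction hM with
  | intro M _ ih =>
    have step : ∀ {N N'}, ArrowPart M N → Step N N' → Types U₀ (tTerm N') := by
      intro N N' h s
      obtain ⟨M', s', h'⟩ := h.step s
      exact ih M' s' N' h'
    intro N
    induction e : sizeOf N using Nat.strong_induction_on generalizing N with
    | _ n ihN =>
      intro h
      have parts : ∀ a b, N = tArr a b → Types U₀ (tTerm a) ∧ Types U₀ (tTerm b) := by
        rintro a b rfl
        simp only [tArr, DTm.app.sizeOf_spec] at e
        exact ⟨ihN _ (by omega) a rfl h.left, ihN _ (by omega) b rfl h.right⟩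
      refine ⟨⟨_, fun X s => ?_⟩, ?_⟩
      · cases s with
        | rule a b =>
          obtain ⟨ha, hb⟩ := parts a b rfl
          exact ha.1.pi hb.1.shift_one
        | appL _ s => cases s
        | appR _ s => exact (step h s).1
      · by_cases harr : ∃ a b, N = tArr a b
        · obtain ⟨a, b, rfl⟩ := harr
          obtain ⟨⟨-, P, hP⟩, -, Q, hQ⟩ := parts a b rfl
          refine ⟨_, .pi (F := fun _ => Q) (.single (.rule a b)) hP fun N _ => ?_⟩
          rwa [DTm.shift_subst0]
        by_cases hn : ∃ N', Step N N'
        · obtain ⟨N', s⟩ := hn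
          obtain ⟨P, hP⟩ := (step h s).2
          exact ⟨P, hP.expand (.single (.appR _ s))⟩
        · have normal : ∀ X, ¬ Step (tTerm N) X := by
            intro X s
            cases s with
            | rule a b => exact harr ⟨a, b, rfl⟩
            | appL _ s => cases s
            | appR _ s => exact hn ⟨_, s⟩
          refine ⟨_, .base (fun B C s => ?_) (fun s => ?_) (fun s => ?_)⟩ <;>
            cases Steps.eq_of_normal normal s

/-! ### Soundness of the interpretation -/

/-- `σ` maps the variables of `G` to reducible terms. -/
def Env (G : List DTm) (σ : ℕ → DTm) : Prop :=
  ∀ n A, G[n]? = some A → ∃ P, Interp U₂ ((A.shift (n+1) 0).subst σ) P ∧ P (σ n)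

theorem Env.nil (σ : ℕ → DTm) : Env [] σ := fun n A h => by simp at h

theorem Env.cons {G : List DTm} {σ : ℕ → DTm} (h : Env G σ) {A N : DTm} {P : DTm → Prop}
    (hA : Interp U₂ (A.subst σ) P) (hN : P N) : Env (A :: G) (DTm.scons N σ) := by
  intro n B hB
  rw [DTm.shift_subst_scons]
  cases n with
  | zero =>
    simp only [List.getElem?_cons_zero, Option.some.injEq] at hB
    subst hB
    exact ⟨P, by rwa [DTm.shift_zero], hN⟩
  | succ n => exact h n B hB

/-- Semantic typing. -/
def SemTyped (G : List DTm) (M A : DTm) : Prop :=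
  ∀ σ, Env G σ → ∃ P, Interp U₂ (A.subst σ) P ∧ P (M.subst σ)

/-- `S` is part of `holSig`. -/
structure PartOfHol (S : Sig) : Prop where
  const : ∀ {c A}, S.constType c = some A → holSig.constType c = some A
  rule : ∀ {G L R}, S.hasRule G L R → holSig.hasRule G L R

/-- The constants of `S` have reducible types. -/
def ConstTypes (S : Sig) : Prop :=
  ∀ c A, S.constType c = some A → ∀ σ, ∃ P, Interp U₂ (A.subst σ) P

theorem Red.mono {S S' : Sig} (hS : ∀ {G L R}, S.hasRule G L R → S'.hasRule G L R)
    {M N : DTm} (h : Red S M N) : Red S' M N := by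
  induction h with
  | beta A M N => exact .beta A M N
  | rew σ h => exact .rew σ (hS h)
  | appL N _ ih => exact .appL N ih
  | appR M _ ih => exact .appR M ih
  | lamTy M _ ih => exact .lamTy M ih
  | lamBody A _ ih => exact .lamBody A ih
  | piL B _ ih => exact .piL B ih
  | piR A _ ih => exact .piR A ih

theorem interp_type : Interp U₂ .type (Types U₀) := .univ .refl (.inl ⟨rfl, rfl⟩)

theorem interp_kind : Interp U₂ .kind (Types U₁) := .univ .refl (.inr ⟨rfl, rfl⟩)

theorem SemTyped.types {G : List DTm} {A : DTm} (h : SemTyped G A .type) {σ : ℕ → DTm}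
    (hσ : Env G σ) : Types U₀ (A.subst σ) := by
  obtain ⟨P, hP, hA⟩ := h σ hσ
  rwa [hP.unique isUniv_U₂ interp_type] at hA

theorem SemTyped.kinds {G : List DTm} {A : DTm} (h : SemTyped G A .kind) {σ : ℕ → DTm}
    (hσ : Env G σ) : Types U₁ (A.subst σ) := by
  obtain ⟨P, hP, hA⟩ := h σ hσ
  rwa [hP.unique isUniv_U₂ interp_kind] at hA

theorem SemTyped.interp {G : List DTm} {A s : DTm} (h : SemTyped G A s)
    (hs : s = .type ∨ s = .kind) {σ : ℕ → DTm} (hσ : Env G σ) :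
    ∃ P, Interp U₂ (A.subst σ) P := by
  rcases hs with rfl | rfl
  · exact (h.types hσ).2.imp fun _ h => h.U₀_le.U₁_le
  · exact (h.kinds hσ).2.imp fun _ h => h.U₁_le

theorem Types.pi {U : DTm → (DTm → Prop) → Prop} {A B : DTm} {σ : ℕ → DTm}
    {Q : DTm → Prop} (hU : IsUniv U) (hA : SN (A.subst σ)) (hQ : Interp U (A.subst σ) Q)
    (hB : ∀ N, Q N → Types U (B.subst (DTm.scons N σ))) :
    Types U ((DTm.pi A B).subst σ) := by
  simp only [← DTm.subst_liftSub_subst0] at hB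
  refine ⟨hA.pi (hB _ ((hQ.cand hU).const (k := 0) (by decide))).1.of_subst, ?_⟩
  choose F hF using fun N : {N // Q N} => (hB N.1 N.2).2
  classical
  refine ⟨_, .pi (F := fun N => if h : Q N then F ⟨N, h⟩ else SN) .refl hQ fun N hN => ?_⟩
  simpa only [dif_pos hN] using hF ⟨N, hN⟩

theorem semTyped_const {S : Sig} (hS : PartOfHol S) (hc : ConstTypes S) {G : List DTm}
    {c : ℕ} {A : DTm} (h : S.constType c = some A) : SemTyped G (.const c) A := by
  intro σ _
  by_cases h4 : c = 4
  · subst h4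
    have hA : A = tyTerm := by
      simpa [holSig, baseSig, Sig.constType, eq_comm] using hS.const h
    subst hA
    exact ⟨fun M => ∀ N, SN N → Types U₀ (.app M N),
      .pi (F := fun _ => Types U₀) .refl interp_cTy fun _ _ => interp_type,
      fun _ hN => types_term hN⟩
  · obtain ⟨P, hP⟩ := hc c A h σ
    exact ⟨P, hP, (hP.cand isUniv_U₂).const h4⟩

theorem semTyped_prod {G : List DTm} {A B s : DTm} (hA : SemTyped G A .type)
    (hB : SemTyped (A :: G) B s) (hs : s = .type ∨ s = .kind) :
    SemTyped G (.pi A B) s := by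
  intro σ hσ
  obtain ⟨snA, Q, hQ⟩ := hA.types hσ
  have env : ∀ N, Q N → Env (A :: G) (DTm.scons N σ) :=
    fun N hN => hσ.cons hQ.U₀_le.U₁_le hN
  rcases hs with rfl | rfl
  · exact ⟨_, interp_type, .pi isUniv_U₀ snA hQ fun N hN => hB.types (env N hN)⟩
  · exact ⟨_, interp_kind, .pi isUniv_U₁ snA hQ.U₀_le fun N hN => hB.kinds (env N hN)⟩

theorem semTyped_abs {G : List DTm} {A M B : DTm} (hA : SemTyped G A .type)
    (hM : SemTyped (A :: G) M B) : SemTyped G (.lam A M) (.pi A B) := by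
  intro σ hσ
  obtain ⟨snA, Q, hQ⟩ := hA.types hσ
  have candQ := hQ.cand isUniv_U₀
  have hM' := fun N (hN : Q N) => hM _ (hσ.cons hQ.U₀_le.U₁_le hN)
  simp only [← DTm.subst_liftSub_subst0] at hM'
  choose F hF using fun N : {N // Q N} => hM' N.1 N.2
  classical
  have hF' : ∀ N (hN : Q N), (if h : Q N then F ⟨N, h⟩ else SN) = F ⟨N, hN⟩ :=
    fun N hN => dif_pos hN
  have candF := fun N : {N // Q N} => (hF N).1.cand isUniv_U₂
  refine ⟨_, .pi (F := fun N => if h : Q N then F ⟨N, h⟩ else SN) .refl hQ.U₀_le.U₁_le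
    fun N hN => ?_, fun N hN => ?_⟩
  · rw [hF' N hN]
    exact (hF ⟨N, hN⟩).1
  · simp only [hF' N hN]
    have h₀ : Q (.const 0) := candQ.const (by decide)
    exact (candF ⟨N, hN⟩).lam_app snA ((candF ⟨_, h₀⟩).sn (hF ⟨_, h₀⟩).2).of_subst
      (candQ.sn hN) (hF ⟨N, hN⟩).2

theorem semTyped_app {G : List DTm} {M N A B : DTm} (hM : SemTyped G M (.pi A B))
    (hN : SemTyped G N A) : SemTyped G (.app M N) (B.subst0 N) := by
  intro σ hσ
  obtain ⟨P, hP, h⟩ := hM σ hσ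
  obtain ⟨Q', hQ', hN'⟩ := hN σ hσ
  obtain ⟨Q, F, hQ, hF, rfl⟩ := hP.pi_inv isUniv_U₂ .refl
  rw [hQ'.unique isUniv_U₂ hQ] at hN'
  rw [DTm.subst_subst0]
  exact ⟨_, hF _ hN', h _ hN'⟩

theorem semTyped_conv {G : List DTm} {M A B : DTm} (hM : SemTyped G M A)
    (h : Conv holSig A B) : SemTyped G M B := by
  intro σ hσ
  obtain ⟨P, hP, hMP⟩ := hM σ hσ
  obtain ⟨X, hAX, hBX⟩ := h.join
  exact ⟨P, (hP.reduce isUniv_U₂ (hAX.subst σ)).expand (hBX.subst σ), hMP⟩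

theorem Typed.sound {S : Sig} {G : List DTm} {M A : DTm} (h : Typed S G M A) :
    PartOfHol S → (∃ σ, Env G σ) ∧ SemTyped G M A := by
  refine Typed.rec
    (motive_1 := fun S _ => PartOfHol S → ConstTypes S)
    (motive_2 := fun S G _ => PartOfHol S → ConstTypes S ∧ ∃ σ, Env G σ)
    (motive_3 := fun S G M A _ => PartOfHol S → (∃ σ, Env G σ) ∧ SemTyped G M A)
    ?_ ?_ ?_ ?_ ?_ ?_ ?_ ?_ ?_ ?_ ?_ ?_ h
  · intro _ c A h
    cases h
  · intro S c A s _ _ hs hc ihS ihA hS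
    have hS' : PartOfHol S := by
      refine ⟨fun {d B} h => hS.const ?_, hS.rule⟩
      have hd : d ≠ c := by
        rintro rfl
        rw [hc] at h
        cases h
      simpa only [Sig.constType, if_neg hd] using h
    intro d B h σ
    simp only [Sig.constType] at h
    split at h
    · cases h
      exact (ihA hS').2.interp hs (.nil σ)
    · exact ihS hS' d B h σ
  · intro S G M N A _ _ _ ihS _ _ hS
    exact ihS ⟨hS.const, fun h => hS.rule (.inr h)⟩
  · intro S _ ih hS
    exact ⟨ih hS, DTm.var, .nil _⟩
  · intro S G A _ _ ihG ihA hS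
    obtain ⟨hc, σ, hσ⟩ := ihG hS
    obtain ⟨P, hP⟩ := (ihA hS).2.interp (.inl rfl) hσ
    exact ⟨hc, _, hσ.cons hP ((hP.cand isUniv_U₂).const (k := 0) (by decide))⟩
  · intro S G n A _ h ih hS
    exact ⟨(ih hS).2, fun σ hσ => hσ n A h⟩
  · intro S G c A _ h ih hS
    exact ⟨(ih hS).2, semTyped_const hS (ih hS).1 h⟩
  · intro S G _ ih hS
    exact ⟨(ih hS).2, fun σ _ => ⟨_, interp_kind, .of_normal step_type_absurd,
      _, .univ .refl ⟨rfl, rfl⟩⟩⟩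
  · intro S G A B s _ _ hs ihA ihB hS
    exact ⟨(ihA hS).1, semTyped_prod (ihA hS).2 (ihB hS).2 hs⟩
  · intro S G A M B _ _ ihA ihM hS
    exact ⟨(ihA hS).1, semTyped_abs (ihA hS).2 (ihM hS).2⟩
  · intro S G M N A B _ _ ihM ihN hS
    exact ⟨(ihM hS).1, semTyped_app (ihM hS).2 (ihN hS).2⟩
  · intro S G M A B _ _ h ihM _ hS
    refine ⟨(ihM hS).1, semTyped_conv (ihM hS).2 ?_⟩
    exact Relation.EqvGen.mono (fun _ _ h => Red.mono hS.rule h) _ _ h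

/-- **Lemma 5 (paper §5).** The reduction relation `→βΣ` of the HOL signature
`Σ` is strongly normalizing on well-typed terms: every well-typed term is
accessible for the inverse of one-step reduction, i.e. there is no infinite
reduction sequence starting from it. -/
theorem strong_normalization (Γ : List DTm) (M A : DTm)
    (h : Typed holSig Γ M A) :
    Acc (fun x y => Red holSig y x) M := by
  obtain ⟨⟨σ, hσ⟩, hM⟩ := h.sound ⟨id, id⟩
  obtain ⟨P, hP, hMP⟩ := hM σ hσ
  exact Subrelation.accessible (fun s => s.step) ((hP.cand isUniv_U₂).sn hMP).of_subst

end HolDk
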